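/- Let σ > 0 and C > 0 be real numbers, let N ≥ 1 be a natural number with σ·N ≥ 8·C², and set ε = 4·C²/(σ·N − 4·C²). Let G, D : ℕ → ℝ be sequences of nonnegative real numbers such that G(i+1) + D(i) ≤ (1 + ε)·G(i) for every i < N. Then for every n ≤ N: G(n) + Σ_{i=0}^{n−1} D(i) ≤ exp(8·C²/σ)·G(0). -/

import Mathlib

/-- A discrete Gronwall inequality with dissipation: if each step of `G` grows by a factor at most
`r ≥ 1` after the dissipated amount `D` is added, then `G` together with the accumulated
dissipation grows at most geometrically. -/
theorem add_sum_range_le_pow_mul {r : ℝ} (hr : 1 ≤ r) {G D : ℕ → ℝ} (hD : ∀ i, 0 ≤ D i) {N : ℕ}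
    (h : ∀ i < N, G (i + 1) + D i ≤ r * G i) {n : ℕ} (hn : n ≤ N) :
    G n + ∑ i ∈ Finset.range n, D i ≤ r ^ n * G 0 := by
  induction n with
  | zero => simp
  | succ n ih =>
    have hsum : 0 ≤ ∑ i ∈ Finset.range n, D i := Finset.sum_nonneg fun i _ => hD i
    calc G (n + 1) + ∑ i ∈ Finset.range (n + 1), D i
        = G (n + 1) + D n + ∑ i ∈ Finset.range n, D i := by rw [Finset.sum_range_succ]; ring
      _ ≤ r * G n + r * ∑ i ∈ Finset.range n, D i :=
          add_le_add (h n hn) (le_mul_of_one_le_left hsum hr)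
      _ = r * (G n + ∑ i ∈ Finset.range n, D i) := by ring
      _ ≤ r * (r ^ n * G 0) :=
          mul_le_mul_of_nonneg_left (ih (Nat.le_of_succ_le hn)) (zero_le_one.trans hr)
      _ = r ^ (n + 1) * G 0 := by ring

/-- Abstracted conclusion of Theorem 2.2 of the paper (discrete energy
boundedness): combining the one-step estimate, the induction, and the
uniform bound `(1+ε)^N ≤ exp(8C²/σ)`. -/
theorem discrete_energy_bounded (σ C : ℝ) (hσ : 0 < σ) (hC : 0 < C)
    (N : ℕ) (hN : 1 ≤ N) (hσN : 8 * C ^ 2 ≤ σ * N)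
    (G D : ℕ → ℝ) (hG : ∀ i, 0 ≤ G i) (hD : ∀ i, 0 ≤ D i)
    (h : ∀ i < N, G (i + 1) + D i ≤ (1 + 4 * C ^ 2 / (σ * N - 4 * C ^ 2)) * G i) :
    ∀ n ≤ N, G n + ∑ i ∈ Finset.range n, D i ≤ Real.exp (8 * C ^ 2 / σ) * G 0 := by
  intro n hn
  have hC2 : 0 < C ^ 2 := by positivity
  have hden : 0 < σ * N - 4 * C ^ 2 := by linarith
  set ε := 4 * C ^ 2 / (σ * N - 4 * C ^ 2) with hε
  have hε0 : 0 ≤ ε := by positivity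
  have hεN : N * ε ≤ 8 * C ^ 2 / σ := by
    rw [hε, mul_div_assoc', div_le_div_iff₀ hden hσ]
    nlinarith [mul_le_mul_of_nonneg_left hσN hC2.le]
  refine (add_sum_range_le_pow_mul (by linarith) hD h hn).trans
    (mul_le_mul_of_nonneg_right ?_ (hG 0))
  calc (1 + ε) ^ n ≤ (1 + ε) ^ N := pow_le_pow_right₀ (by linarith) hn
    _ ≤ Real.exp ε ^ N := by
        gcongr
        linarith [Real.add_one_le_exp ε]
    _ = Real.exp (N * ε) := (Real.exp_nat_mul ε N).symm
    _ ≤ Real.exp (8 * C ^ 2 / σ) := Real.exp_le_exp.mpr hεN
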